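/- Let E be a Banach space, F a Hilbert space with Besselian and Hilbertian basis (b_i), U ⊂ E open, and (f_i)_{i∈J₁} : U → Y(J₁) a C¹ mapping. If CRC+ holds for (f_i)_{i∈J₁} at x₀ with index set J₂ ⊂ J₁, then there exist C¹ functions h_l : Y(J₂) → ℝ, l ∈ J₁ \ J₂, such that f_l(x) = h_l((f_i(x))_{i∈J₂}) for all x in some neighbourhood of x₀ (functional dependence of the non-basic coordinates on the basic ones). -/

import Mathlib

open Filter Topology Set

section Defs

variable {X : Type*} [NormedAddCommGroup X] [NormedSpace ℝ X]

/-- Partial sums of a series `∑_{n ∈ J} a n • v n`, summed in the natural order of `ℕ`. -/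
noncomputable def partialSumOn (J : Set ℕ) (a : ℕ → ℝ) (v : ℕ → X) (N : ℕ) : X :=
  ∑ n ∈ Finset.range N, J.indicator a n • v n

/-- The series `∑_{n ∈ J} a n • v n` converges to `x`. -/
def ConvergesOn (J : Set ℕ) (a : ℕ → ℝ) (v : ℕ → X) (x : X) : Prop :=
  Tendsto (partialSumOn J a v) atTop (𝓝 x)

/-- `(v i)_{i ∈ J}` is a Schauder basis (basic family) for the set `S`. -/
def IsSchauderBasisOn (J : Set ℕ) (v : ℕ → X) (S : Set X) : Prop :=
  ∀ x ∈ S, ∃! a : ℕ → ℝ, (∀ n ∉ J, a n = 0) ∧ ConvergesOn J a v x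

/-- `(v n)` is a Schauder basis of the whole space. -/
def IsSchauderBasis (v : ℕ → X) : Prop :=
  ∀ x : X, ∃! a : ℕ → ℝ,
    Tendsto (fun N => ∑ n ∈ Finset.range N, a n • v n) atTop (𝓝 x)

/-- Boundedly-complete family: bounded partial sums imply convergence. -/
def BoundedlyCompleteOn (J : Set ℕ) (v : ℕ → X) : Prop :=
  ∀ a : ℕ → ℝ, (∃ C : ℝ, ∀ N, ‖partialSumOn J a v N‖ ≤ C) →
    ∃ x, ConvergesOn J a v x

/-- Besselian family: convergence of `∑ a n • v n` forces square-summability. -/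
def BesselianOn (J : Set ℕ) (v : ℕ → X) : Prop :=
  ∀ a : ℕ → ℝ, (∀ n ∉ J, a n = 0) → (∃ x, ConvergesOn J a v x) →
    Summable (fun n => (a n) ^ 2)

/-- Hilbertian family: square-summability forces convergence of `∑ a n • v n`. -/
def HilbertianOn (J : Set ℕ) (v : ℕ → X) : Prop :=
  ∀ a : ℕ → ℝ, (∀ n ∉ J, a n = 0) → Summable (fun n => (a n) ^ 2) →
    ∃ x, ConvergesOn J a v x

/-- The Bouligand (contingent) tangent cone to `Q` at `y`. -/
def bouligandTangentCone (Q : Set X) (y : X) : Set X :=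
  {d | ∃ (yk : ℕ → X) (tk : ℕ → ℝ), (∀ k, yk k ∈ Q) ∧ (∀ k, 0 < tk k) ∧
     Tendsto tk atTop (𝓝 0) ∧ Tendsto yk atTop (𝓝 y) ∧
     Tendsto (fun k => (tk k)⁻¹ • (yk k - y)) atTop (𝓝 d)}

/-- Shrinking family: the biorthogonal functionals form a basis of the dual of the closed span. -/
def ShrinkingOn (J₁ J₂ : Set ℕ) (v : ℕ → X) : Prop :=
  ∃ vs : ℕ → (↥((Submodule.span ℝ (v '' J₁)).topologicalClosure) →L[ℝ] ℝ),
    (∀ i ∈ J₂, ∀ j ∈ J₂,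
        ∀ h : v j ∈ (Submodule.span ℝ (v '' J₁)).topologicalClosure,
        vs i ⟨v j, h⟩ = if i = j then 1 else 0) ∧
    IsSchauderBasisOn J₂ vs Set.univ

end Defs

section CRC

variable {E F : Type*} [NormedAddCommGroup E] [NormedSpace ℝ E]
  [NormedAddCommGroup F] [NormedSpace ℝ F]

/-- The Constant Rank Condition Plus for the family `(f_i)_{i ∈ J₁}` at `x₀`
with basic index set `J₂` and neighbourhood `V`, where `b` is the basis of the
target space and `w j` represents the biorthogonal functional `Df_j(x₀)*` as an
element of `E`. -/
def CRCplus (J₁ J₂ : Set ℕ) (fi : ℕ → E → ℝ) (b : ℕ → F) (w : ℕ → E)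
    (x₀ : E) (V : Set E) : Prop :=
  J₂ ⊆ J₁ ∧ V ∈ 𝓝 x₀ ∧
  -- 1. `(Df_i(x))_{i∈J₂}` is a Schauder basis of the closed span of `(Df_i(x))_{i∈J₁}`
  (∀ x ∈ V, IsSchauderBasisOn J₂ (fun i => fderiv ℝ (fi i) x)
      (((Submodule.span ℝ ((fun i => fderiv ℝ (fi i) x) '' J₁)).topologicalClosure :
        Submodule ℝ (E →L[ℝ] ℝ)) : Set (E →L[ℝ] ℝ))) ∧
  -- 2. for `x ∈ V`, `(Df_i(x))_{i∈J₂}` is equivalent (isomorphic via `z_x`) to `(Df_i(x₀))_{i∈J₂}`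
  (∀ x ∈ V, ∀ a : ℕ → ℝ, (∀ n ∉ J₂, a n = 0) →
    ((∃ φ : E →L[ℝ] ℝ, ConvergesOn J₂ a (fun i => fderiv ℝ (fi i) x) φ) ↔
     (∃ φ : E →L[ℝ] ℝ, ConvergesOn J₂ a (fun i => fderiv ℝ (fi i) x₀) φ))) ∧
  -- 3. the image `(Df_i(x₀))_{i∈J₂}(E)` is closed in `Y(J₂)`
  IsClosed {y : F | ∃ e : E, ConvergesOn J₂ (fun i => fderiv ℝ (fi i) x₀ e) b y} ∧
  -- 4. `(Df_i(x₀))_{i∈J₂}` is a shrinking and boundedly-complete basis of the closed span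
  ShrinkingOn J₁ J₂ (fun i => fderiv ℝ (fi i) x₀) ∧
  BoundedlyCompleteOn J₂ (fun i => fderiv ℝ (fi i) x₀) ∧
  -- 5. Besselian
  BesselianOn J₂ (fun i => fderiv ℝ (fi i) x₀) ∧
  -- 6. the biorthogonal functionals `Df_i(x₀)*` lie in `E`
  (∀ i ∈ J₂, ∀ j ∈ J₂, fderiv ℝ (fi i) x₀ (w j) = if i = j then 1 else 0)

end CRC

section Submersion

/-- Maximality principle of Caristi–Ekeland type for a transitive relation along which a function
bounded below controls the distance. -/
theorem exists_maximal_of_dist_le_sub {X : Type*} [MetricSpace X] [CompleteSpace X]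
    {r : X → X → Prop} (hrefl : ∀ x, r x x) (htrans : ∀ x y z, r x y → r y z → r x z)
    (hclosed : ∀ x, IsClosed {y | r x y}) {ψ : X → ℝ} (hψ : ∀ x, 0 ≤ ψ x)
    (hr : ∀ x y, r x y → dist x y ≤ ψ x - ψ y) (x : X) :
    ∃ z, r x z ∧ ∀ y, r z y → y = z := by
  have hstep : ∀ (n : ℕ) (x : X), ∃ y, r x y ∧ ∀ z, r y z → dist y z ≤ (1 / 2 : ℝ) ^ n := by
    intro n x
    have hbdd : BddBelow (ψ '' {y | r x y}) := ⟨0, by rintro _ ⟨y, -, rfl⟩; exact hψ y⟩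
    obtain ⟨_, ⟨y, hy, rfl⟩, hlt⟩ := exists_lt_of_csInf_lt (s := ψ '' {y | r x y})
      ⟨ψ x, x, hrefl x, rfl⟩ (lt_add_of_pos_right _ (show (0 : ℝ) < (1 / 2) ^ n by positivity))
    refine ⟨y, hy, fun z hz => ?_⟩
    have h1 := csInf_le hbdd ⟨z, htrans _ _ _ hy hz, rfl⟩
    linarith [hr y z hz]
  choose step hstep_r hstep_dist using hstep
  let u : ℕ → X := fun n => Nat.rec x (fun k p => step k p) n
  have hu : ∀ n m, n ≤ m → r (u n) (u m) := by
    intro n m hnm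
    induction m, hnm using Nat.le_induction with
    | base => exact hrefl _
    | succ k _ ih => exact htrans _ _ _ ih (hstep_r k (u k))
  have hcauchy : CauchySeq fun n => u (n + 1) := by
    refine cauchySeq_of_le_tendsto_0' (fun n => (1 / 2 : ℝ) ^ n)
      (fun n m hnm => hstep_dist n (u n) _ (hu (n + 1) (m + 1) (by lia))) ?_
    exact tendsto_pow_atTop_nhds_zero_of_lt_one (by norm_num) (by norm_num)
  obtain ⟨z, hz⟩ := cauchySeq_tendsto_of_complete hcauchy
  have hrz : ∀ n, r (u n) z := fun n =>
    (hclosed (u n)).mem_of_tendsto hz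
      (eventually_atTop.2 ⟨n, fun m hm => hu n (m + 1) (by lia)⟩)
  refine ⟨z, hrz 0, fun y hy => ?_⟩
  refine tendsto_nhds_unique (tendsto_iff_dist_tendsto_zero.2 ?_) hz
  exact squeeze_zero (fun _ => dist_nonneg)
    (fun n => hstep_dist n (u n) y (htrans _ _ _ (hrz (n + 1)) hy))
    (tendsto_pow_atTop_nhds_zero_of_lt_one (by norm_num) (by norm_num))

variable {E K : Type*} [NormedAddCommGroup E] [NormedSpace ℝ E]
  [NormedAddCommGroup K] [NormedSpace ℝ K]

theorem ContinuousLinearMap.exists_comp_eq_of_ker_le {T : E →L[ℝ] K} {m : ℝ} (hm : 0 < m)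
    (hT : ∀ y, ∃ e, T e = y ∧ m * ‖e‖ ≤ ‖y‖) (L : E →L[ℝ] ℝ) (hker : ∀ e, T e = 0 → L e = 0) :
    ∃ A : K →L[ℝ] ℝ, A ∘L T = L := by
  obtain ⟨σ, hσ⟩ := (T : E →ₗ[ℝ] K).exists_rightInverse_of_surjective
    (LinearMap.range_eq_top.2 fun y => (hT y).imp fun _ h => h.1)
  have hσ' : ∀ y, T (σ y) = y := fun y => LinearMap.congr_fun hσ y
  have hfac : ∀ e, L (σ (T e)) = L e := fun e => by
    rw [← sub_eq_zero, ← map_sub]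
    exact hker _ (by rw [map_sub, hσ', sub_self])
  refine ⟨((L : E →ₗ[ℝ] ℝ) ∘ₗ σ).mkContinuous (‖L‖ * m⁻¹) fun y => ?_,
    ContinuousLinearMap.ext hfac⟩
  obtain ⟨e, rfl, he⟩ := hT y
  calc ‖L (σ (T e))‖ = ‖L e‖ := by rw [hfac]
    _ ≤ ‖L‖ * ‖e‖ := L.le_opNorm e
    _ ≤ ‖L‖ * (m⁻¹ * ‖T e‖) := by
        gcongr
        rwa [← div_eq_inv_mul, le_div_iff₀' hm]
    _ = _ := by ring

/-- `g` is linearly open on `s` with modulus `m`. -/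
def LinearlyOpenOn (g : E → K) (m : ℝ) (s : Set E) : Prop :=
  ∀ x ε, 0 ≤ ε → Metric.closedBall x ε ⊆ s →
    SurjOn g (Metric.closedBall x ε) (Metric.closedBall (g x) (m * ε))

/-- If `φ` has derivative factoring through that of `g`, one can move inside a fiber of `g`
towards any prescribed point of the fiber with `φ` varying arbitrarily slowly. -/
theorem exists_fiber_step {g : E → K} {T : E →L[ℝ] K} {c : NNReal} {m : ℝ} {s : Set E}
    (hs : IsOpen s) (hT : ApproximatesLinearOn g T s c) (hcm : 6 * c ≤ m)
    (hopen : LinearlyOpenOn g m s) {φ : E → ℝ} {g' : E →L[ℝ] K} {A : K →L[ℝ] ℝ} {z x : E}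
    (hz : z ∈ s) (hx : x ∈ s) (hzx : g z = g x) (hne : z ≠ x)
    (hg : HasFDerivAt g g' z) (hφ : HasFDerivAt φ (A ∘L g') z) {η : ℝ} (hη : 0 < η) :
    ∃ p, p ≠ z ∧ g p = g z ∧ dist p x + dist p z / 2 ≤ dist z x ∧
      |φ p - φ z| ≤ η * dist p z := by
  have hd : 0 < ‖x - z‖ := norm_pos_iff.2 (sub_ne_zero.2 hne.symm)
  have hψ : HasFDerivAt (fun p => φ p - A (g p)) (0 : E →L[ℝ] ℝ) z := by
    have := hφ.sub (A.hasFDerivAt.comp z hg)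
    rwa [sub_self] at this
  obtain ⟨δ, hδ, hball⟩ := Metric.mem_nhds_iff.1
    (inter_mem (hs.mem_nhds hz) (hψ.isLittleO.def hη))
  set t := min 1 (δ / (2 * ‖x - z‖)) with ht
  have ht0 : 0 < t := lt_min one_pos (by positivity)
  have ht1 : t ≤ 1 := min_le_left _ _
  have htδ : t * ‖x - z‖ ≤ δ / 2 := by
    calc t * ‖x - z‖ ≤ δ / (2 * ‖x - z‖) * ‖x - z‖ := by gcongr; exact min_le_right _ _
      _ = δ / 2 := by field_simp
  have htd : 0 < t * ‖x - z‖ := by positivity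
  set q := z + t • (x - z) with hq
  have hqz : dist q z = t * ‖x - z‖ := by
    rw [dist_eq_norm, hq, add_sub_cancel_left, norm_smul, Real.norm_of_nonneg ht0.le]
  have hqx : dist q x = (1 - t) * ‖x - z‖ := by
    rw [dist_eq_norm, show q - x = -((1 - t) • (x - z)) by rw [hq]; module, norm_neg, norm_smul,
      Real.norm_of_nonneg (by linarith)]
  have hsub : Metric.closedBall q (t * ‖x - z‖ / 3) ⊆ Metric.ball z δ := by
    refine Metric.closedBall_subset_ball' ?_
    linarith
  have hqs : q ∈ s := (hball (by rw [Metric.mem_ball]; linarith)).1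
  have hTd : ‖T (x - z)‖ ≤ c * ‖x - z‖ := by
    have := hT x hx z hz
    rwa [hzx, sub_self, zero_sub, norm_neg] at this
  have hgq : g z ∈ Metric.closedBall (g q) (m * (t * ‖x - z‖ / 3)) := by
    have h1 := hT q hqs z hz
    rw [← dist_eq_norm q z, hqz] at h1
    have h2 : ‖T (q - z)‖ ≤ t * (c * ‖x - z‖) := by
      rw [hq, add_sub_cancel_left, map_smul, norm_smul, Real.norm_of_nonneg ht0.le]
      gcongr
    rw [Metric.mem_closedBall, dist_comm, dist_eq_norm]
    calc ‖g q - g z‖ = ‖(g q - g z - T (q - z)) + T (q - z)‖ := by rw [sub_add_cancel]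
      _ ≤ c * (t * ‖x - z‖) + t * (c * ‖x - z‖) := (norm_add_le _ _).trans (add_le_add h1 h2)
      _ = 6 * c * (t * ‖x - z‖ / 3) := by ring
      _ ≤ _ := by gcongr
  obtain ⟨p, hp, hgp⟩ := hopen q (t * ‖x - z‖ / 3) (by positivity)
    (hsub.trans fun y hy => (hball hy).1) hgq
  have hpq : dist p q ≤ t * ‖x - z‖ / 3 := hp
  refine ⟨p, ?_, hgp, ?_, ?_⟩
  · rintro rfl
    rw [dist_comm, hqz] at hpq
    linarith
  · have h1 := dist_triangle p q x
    have h2 := dist_triangle p q z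
    rw [dist_comm z x, dist_eq_norm x z]
    linarith
  · have := (hball (hsub hp)).2
    simpa [hgp, dist_eq_norm] using this

/-- A function whose derivative factors through that of `g` is constant on the fibers of `g`. -/
theorem eq_of_fiber_eq [CompleteSpace E] {g : E → K} {T : E →L[ℝ] K} {c : NNReal} {m : ℝ}
    {s : Set E} (hs : IsOpen s) (hT : ApproximatesLinearOn g T s c) (hcm : 6 * c ≤ m)
    (hopen : LinearlyOpenOn g m s) {φ : E → ℝ} {g' : E → E →L[ℝ] K} {A : E → K →L[ℝ] ℝ}
    (hg : ∀ z ∈ s, HasFDerivAt g (g' z) z) (hφ : ∀ z ∈ s, HasFDerivAt φ (A z ∘L g' z) z)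
    {x x' : E} (hball : Metric.closedBall x' (dist x x') ⊆ s) (hxx' : g x = g x') :
    φ x = φ x' := by
  have hx's : x' ∈ s := hball (Metric.mem_closedBall_self dist_nonneg)
  set S : Set E := Metric.closedBall x' (dist x x') ∩ g ⁻¹' {g x'} with hS
  have hSclosed : IsClosed S :=
    ContinuousOn.preimage_isClosed_of_isClosed
      (fun z hz => (hg z (hball hz)).continuousAt.continuousWithinAt)
      Metric.isClosed_closedBall isClosed_singleton
  have : CompleteSpace S := hSclosed.completeSpace_coe
  have hφc : Continuous fun z : S => φ z :=
    continuousOn_iff_continuous_domRestrict.1 fun z (hz : z ∈ S) =>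
      (hφ z (hball hz.1)).continuousAt.continuousWithinAt
  have key : ∀ η > 0, |φ x' - φ x| ≤ η * (2 * dist x x') := by
    intro η hη
    obtain ⟨z, ⟨-, hxz⟩, hzmax⟩ := exists_maximal_of_dist_le_sub (X := S)
      (r := fun y z => dist y z ≤ 2 * dist (y : E) x' - 2 * dist (z : E) x' ∧
        |φ z - φ y| ≤ η * (2 * dist (y : E) x' - 2 * dist (z : E) x'))
      (ψ := fun z => 2 * dist (z : E) x')
      (fun y => by simp)
      (fun y z w h1 h2 => ⟨by linarith [dist_triangle y z w, h1.1, h2.1], by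
        have := abs_sub_le (φ w) (φ z) (φ y)
        linarith [h1.2, h2.2]⟩)
      (fun y => by
        refine IsClosed.and (isClosed_le ?_ ?_) (isClosed_le ?_ ?_) <;>
          first | fun_prop | exact (hφc.sub continuous_const).abs)
      (fun z => by positivity) (fun y z h => h.1)
      ⟨x, Metric.mem_closedBall.2 le_rfl, hxx'⟩
    rcases eq_or_ne (z : E) x' with h | h
    · simpa [h] using hxz
    · exfalso
      have hzs := hball z.2.1
      obtain ⟨p, hpz, hgp, hpd, hpφ⟩ := exists_fiber_step hs hT hcm hopen hzs hx's z.2.2 h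
        (hg _ hzs) (hφ _ hzs) hη
      have hpS : p ∈ S := by
        refine ⟨Metric.mem_closedBall.2 ?_, hgp.trans z.2.2⟩
        have := Metric.mem_closedBall.1 z.2.1
        linarith [dist_nonneg (x := p) (y := (z : E))]
      refine hpz (congrArg Subtype.val (hzmax ⟨p, hpS⟩ ⟨?_, hpφ.trans ?_⟩))
      · rw [Subtype.dist_eq, dist_comm]
        simp only
        linarith
      · gcongr
        linarith
  by_contra hne
  have hpos : 0 < |φ x' - φ x| := abs_pos.2 (sub_ne_zero.2 (Ne.symm hne))
  have h1 := key (|φ x' - φ x| / (2 * (2 * dist x x' + 1))) (by positivity)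
  have h2 : |φ x' - φ x| / (2 * (2 * dist x x' + 1)) * (2 * dist x x') < |φ x' - φ x| := by
    rw [div_mul_eq_mul_div, div_lt_iff₀ (by positivity)]
    nlinarith [dist_nonneg (x := x) (y := x')]
  linarith

variable [CompleteSpace E] [CompleteSpace K]

/-- Quantitative open mapping data for a `C¹` map at a point where its derivative is onto. -/
theorem exists_linearlyOpenOn {g : E → K} {U : Set E} (hU : IsOpen U) {x₀ : E} (hx₀ : x₀ ∈ U)
    (hg : ContDiffOn ℝ 1 g U) (hsurj : (fderiv ℝ g x₀).range = ⊤) :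
    ∃ (m : ℝ) (c : NNReal) (ρ : ℝ), 0 < m ∧ 6 * c ≤ m ∧ 0 < ρ ∧ Metric.ball x₀ ρ ⊆ U ∧
      ApproximatesLinearOn g (fderiv ℝ g x₀) (Metric.ball x₀ ρ) c ∧
      LinearlyOpenOn g m (Metric.ball x₀ ρ) ∧
      ∀ x ∈ Metric.ball x₀ ρ, ∀ y, ∃ e, fderiv ℝ g x e = y ∧ m * ‖e‖ ≤ ‖y‖ := by
  set T := fderiv ℝ g x₀ with hTdef
  let R := T.nonlinearRightInverseOfSurjective hsurj
  have hR : 0 < R.nnnorm := T.nonlinearRightInverseOfSurjective_nnnorm_pos hsurj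
  set c : NNReal := R.nnnorm⁻¹ / 7 with hc
  have hc0 : 0 < c := by positivity
  have hcR : (R.nnnorm : ℝ)⁻¹ = 7 * c := by
    rw [hc]; push_cast; ring
  have hm : (R.nnnorm : ℝ)⁻¹ - c = 6 * c := by rw [hcR]; ring
  have hgx₀ : ContDiffAt ℝ 1 g x₀ := hg.contDiffAt (hU.mem_nhds hx₀)
  obtain ⟨s, hs, hsT⟩ := (hgx₀.hasStrictFDerivAt one_ne_zero).approximates_deriv_on_nhds (c := c)
    (Or.inr hc0)
  have hcont : ContinuousAt (fderiv ℝ g) x₀ :=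
    ((hg.continuousOn_fderiv_of_isOpen hU le_rfl).continuousAt (hU.mem_nhds hx₀))
  obtain ⟨ρ, hρ, hball⟩ := Metric.mem_nhds_iff.1 (inter_mem (inter_mem hs (hU.mem_nhds hx₀))
    (hcont.preimage_mem_nhds (Metric.closedBall_mem_nhds _ (NNReal.coe_pos.2 hc0))))
  have hT := hsT.mono_set fun x hx => (hball hx).1.1
  refine ⟨6 * c, c, ρ, by positivity, le_rfl, hρ, fun x hx => (hball hx).1.2, hT,
    fun x ε hε hsub => ?_, fun x hx y => ?_⟩
  · have := hT.surjOn_closedBall_of_nonlinearRightInverse R hε hsub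
    rwa [hm] at this
  · have hx' : ‖fderiv ℝ g x - T‖ ≤ c := by
      rw [← dist_eq_norm]
      exact (hball hx).2
    have happrox : ApproximatesLinearOn (fderiv ℝ g x) T univ c := fun p _ q _ => by
      rw [← map_sub, ← sub_apply]
      exact ContinuousLinearMap.le_of_opNorm_le _ hx' _
    have := happrox.surjOn_closedBall_of_nonlinearRightInverse R (ε := ‖y‖ / (6 * c)) (b := 0)
      (by positivity) (subset_univ _)
    rw [hm, map_zero, mul_div_cancel₀ _ (by positivity)] at this
    obtain ⟨e, he, hey⟩ := this (show y ∈ _ by simp)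
    refine ⟨e, hey, ?_⟩
    rwa [mem_closedBall_zero_iff, le_div_iff₀' (by positivity)] at he

/-- Near a point where the derivative of `g` is onto, every `C¹` function whose derivative
vanishes on the kernel of that of `g` is a `C¹` function of `g`; no splitting of the kernel is
required. -/
theorem exists_contDiffOn_factor {g : E → K} {U : Set E} (hU : IsOpen U) {x₀ : E} (hx₀ : x₀ ∈ U)
    (hg : ContDiffOn ℝ 1 g U) (hsurj : (fderiv ℝ g x₀).range = ⊤) :
    ∃ N, IsOpen N ∧ g x₀ ∈ N ∧ ∃ W ∈ 𝓝 x₀, ∀ φ : E → ℝ, ContDiffOn ℝ 1 φ U →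
      (∀ x ∈ U, ∀ e, fderiv ℝ g x e = 0 → fderiv ℝ φ x e = 0) →
      ∃ H : K → ℝ, ContDiffOn ℝ 1 H N ∧ ∀ x ∈ W, φ x = H (g x) := by
  obtain ⟨m, c, ρ, hm, hcm, hρ, hsU, hT, hopen, hinv⟩ := exists_linearlyOpenOn hU hx₀ hg hsurj
  set s := Metric.ball x₀ ρ with hs
  set B := Metric.ball x₀ (ρ / 3) with hB
  have hBs : B ⊆ s := Metric.ball_subset_ball (by linarith)
  have hgd : ∀ x ∈ U, HasFDerivAt g (fderiv ℝ g x) x := fun x hx =>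
    ((hg.contDiffAt (hU.mem_nhds hx)).differentiableAt one_ne_zero).hasFDerivAt
  have hg'c := hg.continuousOn_fderiv_of_isOpen hU le_rfl
  have hlift : ∀ x ∈ s, ∀ᶠ y in 𝓝 (g x), ∃ p ∈ s, g p = y ∧ m * dist p x ≤ dist y (g x) := by
    intro x hx
    obtain ⟨ε, hε, hεs⟩ := Metric.mem_nhds_iff.1 (Metric.isOpen_ball.mem_nhds hx)
    filter_upwards [Metric.ball_mem_nhds (g x) (mul_pos hm hε)] with y hy
    have hle : m * (dist y (g x) / m) = dist y (g x) := mul_div_cancel₀ _ hm.ne'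
    have hsub : Metric.closedBall x (dist y (g x) / m) ⊆ s :=
      (Metric.closedBall_subset_ball ((div_lt_iff₀' hm).2 hy)).trans hεs
    obtain ⟨p, hp, hpy⟩ := hopen x _ (by positivity) hsub
      (show y ∈ _ by rw [hle]; exact Metric.mem_closedBall.2 le_rfl)
    exact ⟨p, hsub hp, hpy, by rwa [Metric.mem_closedBall, le_div_iff₀' hm] at hp⟩
  set N := Metric.ball (g x₀) (m * (ρ / 3)) with hN
  have hsection : ∀ y ∈ N, ∃ x ∈ B, g x = y := by
    intro y hy
    have hle : m * (dist y (g x₀) / m) = dist y (g x₀) := mul_div_cancel₀ _ hm.ne'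
    have hsub : Metric.closedBall x₀ (dist y (g x₀) / m) ⊆ B :=
      Metric.closedBall_subset_ball ((div_lt_iff₀' hm).2 hy)
    obtain ⟨p, hp, hpy⟩ := hopen x₀ _ (by positivity) (hsub.trans hBs)
      (show y ∈ _ by rw [hle]; exact Metric.mem_closedBall.2 le_rfl)
    exact ⟨p, hsub hp, hpy⟩
  choose! σ hσB hσ using hsection
  have hgx₀N : g x₀ ∈ N := Metric.mem_ball_self (by positivity)
  have hx₀B : x₀ ∈ B := Metric.mem_ball_self (by positivity)
  refine ⟨N, Metric.isOpen_ball, hgx₀N, B ∩ g ⁻¹' N, inter_mem (Metric.isOpen_ball.mem_nhds hx₀B)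
    ((hgd x₀ hx₀).continuousAt.preimage_mem_nhds (Metric.isOpen_ball.mem_nhds hgx₀N)),
    fun φ hφ hker => ?_⟩
  have hφd : ∀ x ∈ U, HasFDerivAt φ (fderiv ℝ φ x) x := fun x hx =>
    ((hφ.contDiffAt (hU.mem_nhds hx)).differentiableAt one_ne_zero).hasFDerivAt
  have hφ'c := hφ.continuousOn_fderiv_of_isOpen hU le_rfl
  have hfac : ∀ x ∈ s, ∃ A : K →L[ℝ] ℝ, A ∘L fderiv ℝ g x = fderiv ℝ φ x := fun x hx =>
    ContinuousLinearMap.exists_comp_eq_of_ker_le hm (hinv x hx) _ (hker x (hsU hx))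
  choose! A hA using hfac
  have hfiber : ∀ x ∈ B, ∀ x' ∈ B, g x = g x' → φ x = φ x' := by
    intro x hx x' hx' h
    refine eq_of_fiber_eq Metric.isOpen_ball hT hcm hopen (A := A)
      (fun z hz => hgd z (hsU hz)) (fun z hz => ?_) ?_ h
    · rw [hA z hz]
      exact hφd z (hsU hz)
    · refine Metric.closedBall_subset_ball' ?_
      have := dist_triangle_right x x' x₀
      rw [hB, Metric.mem_ball] at hx hx'
      linarith
  have hH : ∀ x ∈ B, g x ∈ N → φ (σ (g x)) = φ x := fun x hx hgx =>
    hfiber _ (hσB _ hgx) _ hx (hσ _ hgx)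
  have hHd : ∀ x ∈ B, g x ∈ N → HasFDerivAt (fun y => φ (σ y)) (A x) (g x) := by
    intro x hx hgx
    have hxs := hBs hx
    have hψ : HasFDerivAt (fun p => φ p - A x (g p)) (0 : E →L[ℝ] ℝ) x := by
      have := (hφd x (hsU hxs)).sub ((A x).hasFDerivAt.comp x (hgd x (hsU hxs)))
      rwa [hA x hxs, sub_self] at this
    refine .of_isLittleO (Asymptotics.isLittleO_iff.2 fun η hη => ?_)
    obtain ⟨δ, hδ, hδball⟩ := Metric.mem_nhds_iff.1 (inter_mem (Metric.isOpen_ball.mem_nhds hx)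
      (hψ.isLittleO.def (mul_pos hη hm)))
    filter_upwards [hlift x hxs, Metric.isOpen_ball.mem_nhds hgx,
      Metric.ball_mem_nhds (g x) (mul_pos hm hδ)] with y ⟨p, _, hpy, hpd⟩ hyN hyδ
    have hpδ := hδball (show dist p x < δ from
      lt_of_mul_lt_mul_left (hpd.trans_lt hyδ) hm.le)
    have h1 := hpδ.2
    subst hpy
    simp only [mem_ofPred_eq, zero_apply, sub_zero] at h1
    rw [hH p hpδ.1 hyN, hH x hx hgx, map_sub]
    calc ‖φ p - φ x - (A x (g p) - A x (g x))‖
        = ‖φ p - A x (g p) - (φ x - A x (g x))‖ := by congr 1; ring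
      _ ≤ η * m * ‖p - x‖ := h1
      _ = η * (m * dist p x) := by rw [dist_eq_norm, mul_assoc]
      _ ≤ η * dist (g p) (g x) := by gcongr
      _ = _ := by rw [dist_eq_norm]
  have hAnorm : ∀ x ∈ s, ‖A x‖ ≤ ‖fderiv ℝ φ x‖ / m := by
    intro x hx
    refine ContinuousLinearMap.opNorm_le_bound _ (by positivity) fun y => ?_
    obtain ⟨e, rfl, he⟩ := hinv x hx y
    rw [← ContinuousLinearMap.comp_apply, hA x hx, div_mul_eq_mul_div, le_div_iff₀ hm]
    calc ‖fderiv ℝ φ x e‖ * m ≤ ‖fderiv ℝ φ x‖ * ‖e‖ * m := by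
          gcongr; exact ContinuousLinearMap.le_opNorm _ _
      _ = ‖fderiv ℝ φ x‖ * (m * ‖e‖) := by ring
      _ ≤ _ := by gcongr
  have hAsub : ∀ x ∈ s, ∀ x' ∈ s, ‖A x' - A x‖ ≤ (‖fderiv ℝ φ x'‖ / m *
      ‖fderiv ℝ g x - fderiv ℝ g x'‖ + ‖fderiv ℝ φ x' - fderiv ℝ φ x‖) / m := by
    intro x hx x' hx'
    refine ContinuousLinearMap.opNorm_le_bound _ (by positivity) fun y => ?_
    obtain ⟨e, rfl, he⟩ := hinv x hx y
    have hsplit : (A x' - A x) (fderiv ℝ g x e) =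
        A x' ((fderiv ℝ g x - fderiv ℝ g x') e) + (fderiv ℝ φ x' - fderiv ℝ φ x) e := by
      rw [← hA x hx, ← hA x' hx']
      simp
    rw [hsplit, div_mul_eq_mul_div, le_div_iff₀ hm]
    calc _ ≤ (‖A x'‖ * (‖fderiv ℝ g x - fderiv ℝ g x'‖ * ‖e‖) +
            ‖fderiv ℝ φ x' - fderiv ℝ φ x‖ * ‖e‖) * m := by
          gcongr
          refine (norm_add_le _ _).trans (add_le_add ?_ (ContinuousLinearMap.le_opNorm _ _))
          exact (ContinuousLinearMap.le_opNorm _ _).trans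
            (by gcongr; exact ContinuousLinearMap.le_opNorm _ _)
      _ = (‖A x'‖ * ‖fderiv ℝ g x - fderiv ℝ g x'‖ + ‖fderiv ℝ φ x' - fderiv ℝ φ x‖) *
            (m * ‖e‖) := by ring
      _ ≤ _ := by gcongr; exact hAnorm x' hx'
  have hAcont : ∀ x ∈ s, ContinuousAt A x := by
    intro x hx
    rw [ContinuousAt, tendsto_iff_norm_sub_tendsto_zero]
    have hφc : Tendsto (fderiv ℝ φ) (𝓝 x) (𝓝 (fderiv ℝ φ x)) :=
      hφ'c.continuousAt (hU.mem_nhds (hsU hx))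
    have hgc : Tendsto (fderiv ℝ g) (𝓝 x) (𝓝 (fderiv ℝ g x)) :=
      hg'c.continuousAt (hU.mem_nhds (hsU hx))
    refine squeeze_zero' (Eventually.of_forall fun _ => norm_nonneg _)
      (eventually_of_mem (Metric.isOpen_ball.mem_nhds hx) fun x' hx' => hAsub x hx x' hx') ?_
    have := (((hφc.norm.div_const m).mul (hgc.const_sub (fderiv ℝ g x)).norm).add
      (hφc.sub_const (fderiv ℝ φ x)).norm).div_const m
    simpa using this
  refine ⟨fun y => φ (σ y), ?_, fun x hx => (hH x hx.1 hx.2).symm⟩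
  rw [← zero_add (1 : WithTop ℕ∞), contDiffOn_succ_iff_fderiv_of_isOpen Metric.isOpen_ball]
  refine ⟨fun y hy => ?_, by simp, contDiffOn_zero.2 fun y hy => ?_⟩
  · have := hHd (σ y) (hσB y hy) (by rwa [hσ y hy])
    rw [hσ y hy] at this
    exact this.differentiableAt.differentiableWithinAt
  · obtain ⟨x, hxB, rfl⟩ : ∃ x ∈ B, g x = y := ⟨σ y, hσB y hy, hσ y hy⟩
    have hxs := hBs hxB
    refine ContinuousAt.continuousWithinAt ?_
    have hmap : map g (𝓝 x) = 𝓝 (g x) :=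
      ((hg.contDiffAt (hU.mem_nhds (hsU hxs))).hasStrictFDerivAt one_ne_zero).map_nhds_eq_of_surj
        (LinearMap.range_eq_top.2 fun y => (hinv x hxs y).imp fun _ h => h.1)
    rw [ContinuousAt, ← hmap, tendsto_map'_iff, (hHd x hxB hy).fderiv]
    refine (hAcont x hxs).congr' ?_
    filter_upwards [Metric.isOpen_ball.mem_nhds hxB, (hgd x (hsU hxs)).continuousAt.preimage_mem_nhds
      (Metric.isOpen_ball.mem_nhds hy)] with x' hx' hgx'
    exact (hHd x' hx' hgx').fderiv.symm

theorem exists_contDiff_factor [HasContDiffBump K] {g : E → K} {U : Set E} (hU : IsOpen U)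
    {x₀ : E} (hx₀ : x₀ ∈ U) (hg : ContDiffOn ℝ 1 g U) (hsurj : (fderiv ℝ g x₀).range = ⊤) :
    ∃ W ∈ 𝓝 x₀, ∀ φ : E → ℝ, ContDiffOn ℝ 1 φ U →
      (∀ x ∈ U, ∀ e, fderiv ℝ g x e = 0 → fderiv ℝ φ x e = 0) →
      ∃ H : K → ℝ, ContDiff ℝ 1 H ∧ ∀ x ∈ W, φ x = H (g x) := by
  obtain ⟨N, hN, hx₀N, W, hW, hfac⟩ := exists_contDiffOn_factor hU hx₀ hg hsurj
  obtain ⟨ε, hε, hεN⟩ := Metric.mem_nhds_iff.1 (hN.mem_nhds hx₀N)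
  let χ : ContDiffBump (g x₀) := ⟨ε / 3, ε / 2, by positivity, by linarith⟩
  have hgc : ContinuousAt g x₀ := hg.continuousOn.continuousAt (hU.mem_nhds hx₀)
  refine ⟨W ∩ g ⁻¹' Metric.closedBall (g x₀) (ε / 3), inter_mem hW
    (hgc.preimage_mem_nhds (Metric.closedBall_mem_nhds _ (by positivity))), fun φ hφ hker => ?_⟩
  obtain ⟨H, hH, hφH⟩ := hfac φ hφ hker
  refine ⟨fun y => χ y * H y, contDiff_iff_contDiffAt.2 fun y => ?_, fun x hx => ?_⟩
  · by_cases hy : y ∈ tsupport χ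
    · rw [χ.tsupport_eq] at hy
      have hyN : y ∈ N := hεN (Metric.closedBall_subset_ball (by simp only [χ]; linarith) hy)
      exact χ.contDiffAt.mul (hH.contDiffAt (hN.mem_nhds hyN))
    · refine (contDiffAt_const (c := (0 : ℝ))).congr_of_eventuallyEq ?_
      filter_upwards [notMem_tsupport_iff_eventuallyEq.1 hy] with z hz
      simp [hz]
  · simp only [χ.one_of_mem_closedBall hx.2, one_mul, hφH x hx.1]

end Submersion

section SquareSummable

local notation "ℓ²" => lp (fun _ : ℕ => ℝ) 2

theorem memℓp_two_of_summable_sq {a : ℕ → ℝ} (ha : Summable fun n => (a n) ^ 2) :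
    Memℓp a 2 := memℓp_gen (by simpa using ha)

theorem summable_sq_l2 (a : ℓ²) : Summable fun n => (a n) ^ 2 := by
  simpa using (lp.memℓp a).summable (by simp)

/-- The square-summable sequences supported in `J`. -/
def l2SupportedOn (J : Set ℕ) : Submodule ℝ ℓ² where
  carrier := {a | ∀ n ∉ J, a n = 0}
  add_mem' ha hb n hn := by simp [ha n hn, hb n hn]
  zero_mem' n _ := by simp
  smul_mem' c a ha n hn := by simp [ha n hn]

theorem isClosed_l2SupportedOn (J : Set ℕ) : IsClosed (l2SupportedOn J : Set ℓ²) := by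
  have : (l2SupportedOn J : Set ℓ²) = ⋂ n ∈ Jᶜ, (lp.evalCLM ℝ (fun _ : ℕ => ℝ) 2 n) ⁻¹' {0} := by
    ext a
    simp [lp.evalCLM]
    rfl
  rw [this]
  exact isClosed_biInter fun n _ => isClosed_singleton.preimage (ContinuousLinearMap.continuous _)

instance (J : Set ℕ) : CompleteSpace (l2SupportedOn J) :=
  (isClosed_l2SupportedOn J).completeSpace_coe

theorem single_mem_l2SupportedOn {J : Set ℕ} {n : ℕ} (hn : n ∈ J) :
    lp.single 2 n (1 : ℝ) ∈ l2SupportedOn J := fun _ hm =>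
  lp.single_apply_ne _ _ _ fun h => hm (h ▸ hn)

theorem orthogonalProjectionOnto_l2SupportedOn (J : Set ℕ) (a : ℓ²) (n : ℕ) :
    ((l2SupportedOn J).orthogonalProjectionOnto a : ℓ²) n = J.indicator a n := by
  by_cases hn : n ∈ J
  · have := (l2SupportedOn J).sub_starProjection_mem_orthogonal a _
      (single_mem_l2SupportedOn hn)
    rw [lp.inner_single_left] at this
    simp only [lp.coeFn_sub, Pi.sub_apply, RCLike.inner_apply, map_one, mul_one] at this
    rw [indicator_of_mem hn]
    exact (sub_eq_zero.1 this).symm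
  · rw [indicator_of_notMem hn]
    exact ((l2SupportedOn J).orthogonalProjectionOnto a).2 n hn

variable {F : Type*} [NormedAddCommGroup F] [NormedSpace ℝ F]

theorem partialSumOn_univ (a : ℕ → ℝ) (b : ℕ → F) :
    partialSumOn univ a b = fun N => ∑ n ∈ Finset.range N, a n • b n := by
  funext N
  simp [partialSumOn]

theorem convergesOn_univ_indicator {J : Set ℕ} {a : ℕ → ℝ} {b : ℕ → F} {y : F} :
    ConvergesOn univ (J.indicator a) b y ↔ ConvergesOn J a b y := by
  rw [ConvergesOn, partialSumOn_univ]
  rfl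

/-- A Besselian and Hilbertian basis identifies the space with `ℓ²`. -/
theorem exists_l2_equiv [CompleteSpace F] {b : ℕ → F} (hb : IsSchauderBasis b)
    (hbBess : BesselianOn univ b) (hbHilb : HilbertianOn univ b) :
    ∃ Φ : ℓ² ≃L[ℝ] F, ∀ (J : Set ℕ) (a : ℕ → ℝ) (y : F),
      ConvergesOn J a b y ↔ (Φ.symm y : ℕ → ℝ) = J.indicator a := by
  have hb' : ∀ y, ∃! a : ℕ → ℝ, ConvergesOn univ a b y := fun y => by
    simpa only [ConvergesOn, partialSumOn_univ] using hb y
  choose S hS using fun a : ℓ² => hbHilb a (by simp) (summable_sq_l2 a)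
  let G : ℕ → ℓ² →L[ℝ] F := fun N =>
    ∑ n ∈ Finset.range N, (lp.evalCLM ℝ (fun _ : ℕ => ℝ) 2 n).smulRight (b n)
  have hG : Tendsto (fun N a => G N a) atTop (𝓝 S) := tendsto_pi_nhds.2 fun a => by
    have := hS a
    simp only [ConvergesOn, partialSumOn_univ] at this
    refine this.congr fun N => ?_
    simp [G, lp.evalCLM]
  let Ψ : ℓ² →L[ℝ] F := continuousLinearMapOfTendsto G hG
  have hΨ : ∀ a : ℓ², ConvergesOn univ a b (Ψ a) := hS
  have hinj : Function.Injective Ψ := fun a a' h =>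
    lp.ext ((hb' (Ψ a')).unique (h ▸ hΨ a) (hΨ a'))
  have hsurj : Function.Surjective Ψ := fun y => by
    obtain ⟨a, ha, -⟩ := hb' y
    let a' : ℓ² := ⟨a, memℓp_two_of_summable_sq (hbBess a (by simp) ⟨y, ha⟩)⟩
    exact ⟨a', tendsto_nhds_unique (hΨ a') ha⟩
  let Φ := ContinuousLinearEquiv.ofBijective Ψ (LinearMap.ker_eq_bot.2 hinj)
    (LinearMap.range_eq_top.2 hsurj)
  have hΦ : ∀ y, ConvergesOn univ (Φ.symm y) b y := fun y => by
    have := hΨ (Φ.symm y)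
    rwa [show Ψ (Φ.symm y) = y from Φ.apply_symm_apply y] at this
  refine ⟨Φ, fun J a y => ⟨fun h => ?_, fun h => ?_⟩⟩
  · exact (hb' y).unique (hΦ y) (convergesOn_univ_indicator.2 h)
  · rw [← convergesOn_univ_indicator, ← h]
    exact hΦ y

end SquareSummable

theorem IsSchauderBasisOn.apply_eq_zero {E : Type*} [NormedAddCommGroup E] [NormedSpace ℝ E]
    {J : Set ℕ} {L : ℕ → E →L[ℝ] ℝ} {S : Set (E →L[ℝ] ℝ)} (h : IsSchauderBasisOn J L S)
    {φ : E →L[ℝ] ℝ} (hφ : φ ∈ S) {e : E} (he : ∀ n ∈ J, L n e = 0) : φ e = 0 := by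
  obtain ⟨a, ⟨-, ha⟩, -⟩ := h φ hφ
  have h1 := ((ContinuousLinearMap.apply ℝ ℝ e).continuous.tendsto φ).comp ha
  refine tendsto_nhds_unique h1 (tendsto_const_nhds.congr fun N => ?_)
  simp only [partialSumOn, Function.comp_apply, map_sum, map_smul, ContinuousLinearMap.apply_apply]
  refine (Finset.sum_eq_zero fun n _ => ?_).symm
  by_cases hn : n ∈ J <;> simp [hn, he]

theorem stmt18 {E F : Type*} [NormedAddCommGroup E] [NormedSpace ℝ E] [CompleteSpace E]
    [NormedAddCommGroup F] [InnerProductSpace ℝ F] [CompleteSpace F]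
    (b : ℕ → F) (hb : IsSchauderBasis b)
    (hbBess : BesselianOn Set.univ b) (hbHilb : HilbertianOn Set.univ b)
    (U : Set E) (hU : IsOpen U) (x₀ : E) (hx₀ : x₀ ∈ U)
    (J₁ J₂ : Set ℕ) (fi : ℕ → E → ℝ) (f : E → F)
    -- `(f_i)_{i∈J₁} : U → Y(J₁)` is of class `C¹`, realized as the `F`-valued map `f`
    (hf : ContDiffOn ℝ 1 f U)
    (hrep : ∀ x ∈ U, ConvergesOn J₁ (fun i => fi i x) b (f x))
    (V : Set E) (hVU : V ⊆ U) (w : ℕ → E)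
    (hcrc : CRCplus J₁ J₂ fi b w x₀ V) :
    -- functional dependence of the non-basic coordinates on the basic ones:
    -- the functions `h_l : Y(J₂) → ℝ` are realized as `C¹` functions on `F`
    ∃ (h : ℕ → F → ℝ) (W : Set E), W ∈ 𝓝 x₀ ∧
      (∀ l ∈ J₁ \ J₂, ContDiff ℝ 1 (h l)) ∧
      ∀ x ∈ W, ∀ l ∈ J₁ \ J₂, ∀ y : F,
        ConvergesOn J₂ (fun i => fi i x) b y → fi l x = h l y := by
  obtain ⟨hJ, hV, hbasis, -, hclosed, -, -, -, hw⟩ := hcrc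
  obtain ⟨Φ, hΦ⟩ := exists_l2_equiv hb hbBess hbHilb
  let P := (l2SupportedOn J₂).orthogonalProjectionOnto
  let ev := fun n => lp.evalCLM ℝ (fun _ : ℕ => ℝ) 2 n
  let Ψ : F →L[ℝ] l2SupportedOn J₂ := P ∘L Φ.symm
  have hΨ : ∀ y n, (Ψ y).1 n = J₂.indicator (Φ.symm y) n := fun y n =>
    orthogonalProjectionOnto_l2SupportedOn J₂ _ n
  have hfi : ∀ n ∈ J₁, ∀ x ∈ U, fi n x = (ev n ∘L Φ.symm) (f x) := fun n hn x hx => by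
    have := congrFun ((hΦ _ _ _).1 (hrep x hx)) n
    rw [indicator_of_mem hn] at this
    exact this.symm
  have hfd : ∀ x ∈ U, HasFDerivAt f (fderiv ℝ f x) x := fun x hx =>
    ((hf.contDiffAt (hU.mem_nhds hx)).differentiableAt one_ne_zero).hasFDerivAt
  have hfi' : ∀ n ∈ J₁, ∀ x ∈ U, ∀ e, fderiv ℝ (fi n) x e = Φ.symm (fderiv ℝ f x e) n := by
    intro n hn x hx e
    have h1 := ((ev n ∘L (Φ.symm : F →L[ℝ] _)).hasFDerivAt.comp x (hfd x hx)).congr_of_eventuallyEq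
      (eventually_of_mem (hU.mem_nhds hx) (hfi n hn))
    rw [h1.fderiv]
    rfl
  have hg' : ∀ x ∈ U, fderiv ℝ (Ψ ∘ f) x = Ψ ∘L fderiv ℝ f x := fun x hx =>
    (Ψ.hasFDerivAt.comp x (hfd x hx)).fderiv
  have hcoord : ∀ x ∈ U, ∀ e n, (fderiv ℝ (Ψ ∘ f) x e).1 n =
      J₂.indicator (fun i => fderiv ℝ (fi i) x e) n := by
    intro x hx e n
    rw [hg' x hx, ContinuousLinearMap.comp_apply, hΨ]
    by_cases hn : n ∈ J₂
    · simp [hn, hfi' n (hJ hn) x hx e]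
    · simp [hn]
  have hsurj : (fderiv ℝ (Ψ ∘ f) x₀).range = ⊤ := by
    set T := fderiv ℝ (Ψ ∘ f) x₀
    have hrange : IsClosed (T.range : Set (l2SupportedOn J₂)) := by
      convert hclosed.preimage (Φ.continuous.comp continuous_subtype_val) using 1
      ext k
      refine exists_congr fun e => ?_
      rw [hΦ, Function.comp_apply, Φ.symm_apply_apply, ← funext (hcoord x₀ hx₀ e)]
      exact ⟨fun h => by rw [← h]; rfl, fun h => Subtype.ext (lp.ext h.symm)⟩
    have : CompleteSpace T.range := hrange.completeSpace_coe
    rw [← Submodule.orthogonal_eq_bot_iff, Submodule.eq_bot_iff]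
    refine fun k hk => Subtype.ext (lp.ext (funext fun n => ?_))
    by_cases hn : n ∈ J₂
    · have hTw : (T (w n)).1 = lp.single 2 n (1 : ℝ) := by
        refine lp.ext (funext fun i => ?_)
        rw [hcoord x₀ hx₀, lp.single_apply]
        by_cases hi : i ∈ J₂
        · rw [indicator_of_mem hi, hw i hi n hn, Pi.single_apply]
        · have hne : i ≠ n := fun h => hi (h ▸ hn)
          rw [indicator_of_notMem hi, Pi.single_eq_of_ne hne]
      have := hk _ ⟨w n, rfl⟩
      rw [Submodule.coe_inner] at this
      erw [hTw] at this
      rw [lp.inner_single_left] at this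
      simpa using this
    · exact k.2 n hn
  have hVU' : interior V ⊆ U := interior_subset.trans hVU
  obtain ⟨W, hW, hfac⟩ := exists_contDiff_factor isOpen_interior (mem_interior_iff_mem_nhds.2 hV)
    (Ψ.contDiff.comp_contDiffOn (hf.mono hVU')) hsurj
  have hH : ∀ l ∈ J₁ \ J₂, ∃ H : l2SupportedOn J₂ → ℝ, ContDiff ℝ 1 H ∧
      ∀ x ∈ W, fi l x = H (Ψ (f x)) := by
    intro l hl
    refine hfac (fi l) ?_ fun x hx e he => ?_
    · exact (((ev l ∘L (Φ.symm : F →L[ℝ] _)).contDiff.comp_contDiffOn hf).congr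
        (hfi l hl.1)).mono hVU'
    · refine (hbasis x (interior_subset hx)).apply_eq_zero
        (Submodule.le_topologicalClosure _ (Submodule.subset_span ⟨l, hl.1, rfl⟩)) fun n hn => ?_
      have := hcoord x (hVU' hx) e n
      rw [he, indicator_of_mem hn] at this
      exact this.symm
  choose! H hHC hHW using hH
  refine ⟨fun l y => H l (Ψ y), W ∩ U, inter_mem hW (hU.mem_nhds hx₀),
    fun l hl => (hHC l hl).comp Ψ.contDiff, fun x hx l hl y hy => ?_⟩
  rw [hHW l hl x hx.1]
  refine congrArg (H l) (Subtype.ext (lp.ext (funext fun n => ?_)))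
  rw [hΨ, hΨ, (hΦ _ _ _).1 hy, (hΦ _ _ _).1 (hrep x hx.2), indicator_indicator,
    indicator_indicator, inter_self, inter_eq_left.2 hJ]
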